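/- arXiv:1005.0832 — 3 statements merged into one kernel-verified Lean document; each statement's English description precedes it below -/
import Mathlib

section
/- Let β ∈ (0,2) and let f : [1,∞) → [1,∞) satisfy k · f(k)^{−β} → 0 as k → ∞. Then there exist C > 0 and k₀ ≥ 1 such that for every integer k ≥ k₀ and every real ρ with 0 < ρ ≤ k − f(k), one has | ∫₀^1 e^{ρ t} (1−t)^k dt − 1/(k−ρ) | ≤ C k / (k−ρ)^{β+1}. -/
open MeasureTheory

lemma exp_mul_one_sub_pow_le (k : ℕ) (ρ t : ℝ) (ht : t ≤ 1) :
    Real.exp (ρ * t) * (1 - t) ^ k ≤ Real.exp (-(k - ρ) * t) := by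
  have h : (1 - t) ^ k ≤ Real.exp (-t) ^ k :=
    pow_le_pow_left₀ (by linarith) (by linarith [Real.add_one_le_exp (-t)]) k
  calc Real.exp (ρ * t) * (1 - t) ^ k ≤ Real.exp (ρ * t) * Real.exp (-t) ^ k := by gcongr
    _ = Real.exp (-(k - ρ) * t) := by
      rw [← Real.exp_nat_mul, ← Real.exp_add]; ring_nf

lemma le_exp_mul_one_sub_pow (k : ℕ) (ρ t : ℝ) (ht₀ : 0 ≤ t) (ht : t ≤ 1) :
    Real.exp (-(k - ρ) * t) * (1 - k * t ^ 2) ≤ Real.exp (ρ * t) * (1 - t) ^ k := by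
  have h_bern : 1 - k * t ^ 2 ≤ (1 - t ^ 2) ^ k := by
    have := one_add_mul_le_pow (a := -t ^ 2) (by nlinarith) k
    calc 1 - k * t ^ 2 = 1 + k * (-t ^ 2) := by ring
      _ ≤ (1 + -t ^ 2) ^ k := this
      _ = (1 - t ^ 2) ^ k := by ring
  have h_pow : (1 - t ^ 2) ^ k ≤ (Real.exp t * (1 - t)) ^ k :=
    pow_le_pow_left₀ (by nlinarith) (by nlinarith [Real.add_one_le_exp t]) k
  calc Real.exp (-(k - ρ) * t) * (1 - k * t ^ 2)
      ≤ Real.exp (-(k - ρ) * t) * (Real.exp t * (1 - t)) ^ k := by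
        gcongr; exact h_bern.trans h_pow
    _ = Real.exp (ρ * t) * (1 - t) ^ k := by
      rw [mul_pow, ← Real.exp_nat_mul, ← mul_assoc, ← Real.exp_add]; ring_nf

lemma integral_exp_neg_mul_le {m : ℝ} (hm : 0 < m) :
    ∫ t in (0:ℝ)..1, Real.exp (-m * t) ≤ 1 / m := by
  rw [intervalIntegral.integral_comp_mul_left Real.exp (neg_ne_zero.mpr hm.ne'), integral_exp,
    smul_eq_mul, inv_neg, neg_mul_comm, one_div]
  refine mul_le_of_le_one_right (by positivity) ?_
  simp only [mul_zero, Real.exp_zero]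
  linarith [Real.exp_pos (-m * 1)]

lemma le_integral_exp_neg_mul_mul {m c : ℝ} (hm : 0 < m) (hc : 1 ≤ c) :
    1 / m - 2 * c / m ^ 3 ≤ ∫ t in (0:ℝ)..1, Real.exp (-m * t) * (1 - c * t ^ 2) := by
  have h_deriv : ∀ t ∈ Set.uIcc (0:ℝ) 1, HasDerivAt
      (fun t : ℝ => Real.exp (-m * t) * (-(1 / m) + c * (t ^ 2 / m + 2 * t / m ^ 2 + 2 / m ^ 3)))
      (Real.exp (-m * t) * (1 - c * t ^ 2)) t := by
    intro t _
    have h₁ : HasDerivAt (fun t : ℝ => Real.exp (-m * t)) (Real.exp (-m * t) * (-m * 1)) t :=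
      ((hasDerivAt_id t).const_mul (-m)).exp
    have h₂ : HasDerivAt
        (fun t : ℝ => -(1 / m) + c * (t ^ 2 / m + 2 * t / m ^ 2 + 2 / m ^ 3))
        (c * (2 * t / m + 2 * 1 / m ^ 2)) t := by
      have h_sq : HasDerivAt (fun t : ℝ => t ^ 2) (2 * t) t := by
        simpa using hasDerivAt_pow 2 t
      exact ((((h_sq.div_const m).add
        (((hasDerivAt_id t).const_mul 2).div_const (m ^ 2))).add_const _).const_mul c).const_add _
    refine (h₁.mul h₂).congr_deriv ?_
    field_simp
    ring
  rw [intervalIntegral.integral_eq_sub_of_hasDerivAt h_deriv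
    (Continuous.intervalIntegrable (by fun_prop) _ _)]
  have h_end : 0 ≤ Real.exp (-m * 1) *
      (-(1 / m) + c * (1 ^ 2 / m + 2 * 1 / m ^ 2 + 2 / m ^ 3)) := by
    have h : -(1 / m) + c * (1 ^ 2 / m + 2 * 1 / m ^ 2 + 2 / m ^ 3) =
        (c - 1) / m + c * (2 / m ^ 2 + 2 / m ^ 3) := by ring
    rw [h]
    have : 0 ≤ c - 1 := by linarith
    positivity
  have h_zero : Real.exp (-m * 0) *
      (-(1 / m) + c * (0 ^ 2 / m + 2 * 0 / m ^ 2 + 2 / m ^ 3)) = -(1 / m) + 2 * c / m ^ 3 := by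
    simp only [mul_zero, Real.exp_zero]; ring
  rw [h_zero]
  linarith

lemma abs_integral_exp_mul_one_sub_pow_sub_le {k : ℕ} (hk : 1 ≤ k) {ρ : ℝ} (hρ : ρ < k) :
    |(∫ t in (0:ℝ)..1, Real.exp (ρ * t) * (1 - t) ^ k) - 1 / ((k : ℝ) - ρ)| ≤
      2 * k / ((k : ℝ) - ρ) ^ 3 := by
  have hm : 0 < (k : ℝ) - ρ := by linarith
  have hk' : (1 : ℝ) ≤ k := by exact_mod_cast hk
  have h_upper : ∫ t in (0:ℝ)..1, Real.exp (ρ * t) * (1 - t) ^ k ≤ 1 / ((k : ℝ) - ρ) :=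
    (intervalIntegral.integral_mono_on zero_le_one
      (Continuous.intervalIntegrable (by fun_prop) _ _)
      (Continuous.intervalIntegrable (by fun_prop) _ _)
      fun t ht => exp_mul_one_sub_pow_le k ρ t ht.2).trans (integral_exp_neg_mul_le hm)
  have h_lower := (le_integral_exp_neg_mul_mul hm hk').trans
    (intervalIntegral.integral_mono_on zero_le_one
      (Continuous.intervalIntegrable (by fun_prop) _ _)
      (Continuous.intervalIntegrable (by fun_prop) _ _)
      fun t ht => le_exp_mul_one_sub_pow k ρ t ht.1 ht.2)
  have h_nonneg : 0 ≤ 2 * k / ((k : ℝ) - ρ) ^ 3 := by positivity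
  rw [abs_le]
  constructor <;> linarith

/-- for β ∈ (0,2) and f : [1,∞) → [1,∞) with k f(k)^{−β} → 0, there are C > 0
and k₀ ≥ 1 such that for integers k ≥ k₀ and 0 < ρ ≤ k − f(k),
|∫₀¹ e^{ρt}(1−t)^k dt − 1/(k−ρ)| ≤ C k/(k−ρ)^{β+1}. -/
theorem statement4 (β : ℝ) (hβ : β ∈ Set.Ioo (0:ℝ) 2) (f : ℝ → ℝ)
    (hf_dom : ∀ x : ℝ, 1 ≤ x → 1 ≤ f x)
    (hf_lim : Filter.Tendsto (fun x : ℝ => x * (f x) ^ (-β)) Filter.atTop (nhds 0)) :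
    ∃ C > 0, ∃ k₀ : ℕ, 1 ≤ k₀ ∧ ∀ k : ℕ, k₀ ≤ k → ∀ ρ : ℝ, 0 < ρ → ρ ≤ (k : ℝ) - f k →
      |(∫ t in (0:ℝ)..1, Real.exp (ρ * t) * (1 - t) ^ k) - 1 / ((k : ℝ) - ρ)| ≤
        C * k / ((k : ℝ) - ρ) ^ (β + 1) := by
  refine ⟨2, two_pos, 1, le_rfl, fun k hk ρ _ hρ => ?_⟩
  have hk' : (1 : ℝ) ≤ k := by exact_mod_cast hk
  have hm : 1 ≤ (k : ℝ) - ρ := by linarith [hf_dom k hk']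
  refine (abs_integral_exp_mul_one_sub_pow_sub_le hk (by linarith)).trans ?_
  have h_pow : ((k : ℝ) - ρ) ^ (β + 1) ≤ ((k : ℝ) - ρ) ^ 3 := by
    rw [← Real.rpow_natCast]
    exact Real.rpow_le_rpow_of_exponent_le hm (by norm_num; linarith [hβ.2])
  have h_pos : 0 < ((k : ℝ) - ρ) ^ (β + 1) := Real.rpow_pos_of_pos (by linarith) _
  gcongr
end

section
/- Let b > 0 and q ≥ 1. There exists C_q > 0 such that for every integer k ≥ q and every R > 0, writing ρ := bR²/2, one has | ν_{q,k}(R) − (1/(k! q!)) ∫₀^{ρ} e^{−ξ} ξ^{k−q} (k−ξ)^{2q} dξ | ≤ (C_q / k) · (1/(k! q!)) ∫₀^{ρ} e^{−ξ} ξ^{k−q} (k+ξ)^{2q} dξ. -/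
open MeasureTheory

noncomputable section

/-- The generalized Laguerre polynomial L_q^{(k−q)}(ξ) = Σ_{l=max(0,q−k)}^{q} C(k,q−l) (−ξ)^l / l!. -/
noncomputable def lag (q k : ℕ) (ξ : ℝ) : ℝ :=
  ∑ l ∈ Finset.Icc (q - k) q, (k.choose (q - l) : ℝ) * (-ξ) ^ l / l.factorial

/-- ν_{q,k}(R) = (q!/k!) ∫₀^{bR²/2} ξ^{k−q} [L_q^{(k−q)}(ξ)]² e^{−ξ} dξ  (real exponent k−q). -/
noncomputable def nu (b : ℝ) (q k : ℕ) (R : ℝ) : ℝ :=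
  (q.factorial / k.factorial : ℝ) *
    ∫ ξ in (0:ℝ)..(b * R ^ 2 / 2), ξ ^ ((k : ℝ) - q) * (lag q k ξ) ^ 2 * Real.exp (-ξ)


/-- The rescaled Laguerre polynomial `q! L_q^{(k-q)}` in terms of falling factorials. -/
theorem factorial_mul_lag {q k : ℕ} (hqk : q ≤ k) (ξ : ℝ) :
    (q.factorial : ℝ) * lag q k ξ =
      ∑ l ∈ Finset.range (q + 1), (-ξ) ^ l * (k.descFactorial (q - l) : ℝ) * (q.choose l : ℝ) := by
  have hset : Finset.Icc (q - k) q = Finset.range (q + 1) := by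
    ext l
    simp only [Finset.mem_Icc, Finset.mem_range]
    omega
  rw [lag, hset, Finset.mul_sum]
  refine Finset.sum_congr rfl fun l hl => ?_
  have hlq : l ≤ q := Nat.lt_succ_iff.mp (Finset.mem_range.mp hl)
  have hq : (q.factorial : ℝ) = q.choose l * l.factorial * (q - l).factorial :=
    mod_cast (Nat.choose_mul_factorial_mul_factorial hlq).symm
  have hd : (k.descFactorial (q - l) : ℝ) = (q - l).factorial * k.choose (q - l) :=
    mod_cast Nat.descFactorial_eq_factorial_mul_choose k (q - l)
  have hl0 : (l.factorial : ℝ) ≠ 0 := mod_cast l.factorial_ne_zero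
  rw [hq, hd]
  field_simp

theorem cast_descFactorial_le_pow (k m : ℕ) : (k.descFactorial m : ℝ) ≤ (k : ℝ) ^ m :=
  mod_cast Nat.descFactorial_le_pow k m

theorem mul_pow_sub_descFactorial_le (k m : ℕ) :
    (k : ℝ) * ((k : ℝ) ^ m - k.descFactorial m) ≤ (m : ℝ) ^ 2 * (k : ℝ) ^ m := by
  induction m with
  | zero => simp
  | succ m ih =>
    have hrec : (k.descFactorial (m + 1) : ℝ) = ((k : ℝ) - m) * k.descFactorial m := by
      rcases le_or_gt m k with h | h
      · rw [Nat.descFactorial_succ, Nat.cast_mul, Nat.cast_sub h]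
      · simp [Nat.descFactorial_succ, Nat.descFactorial_of_lt h]
    have hle := mul_le_mul_of_nonneg_left (cast_descFactorial_le_pow k m) (Nat.cast_nonneg (α := ℝ) m)
    have hm : (0 : ℝ) ≤ ((m : ℝ) + 1) * (k : ℝ) ^ m := by positivity
    have key : (k : ℝ) * ((k : ℝ) ^ m - k.descFactorial m) + m * k.descFactorial m ≤
        ((m : ℝ) + 1) ^ 2 * (k : ℝ) ^ m := by
      linarith
    calc (k : ℝ) * ((k : ℝ) ^ (m + 1) - k.descFactorial (m + 1))
        = k * ((k : ℝ) * ((k : ℝ) ^ m - k.descFactorial m) + m * k.descFactorial m) := by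
          rw [hrec]; ring
      _ ≤ k * (((m : ℝ) + 1) ^ 2 * (k : ℝ) ^ m) := by gcongr
      _ = ((m + 1 : ℕ) : ℝ) ^ 2 * (k : ℝ) ^ (m + 1) := by push_cast; ring

theorem abs_factorial_mul_lag_le {q k : ℕ} (hqk : q ≤ k) {ξ : ℝ} (hξ : 0 ≤ ξ) :
    |(q.factorial : ℝ) * lag q k ξ| ≤ ((k : ℝ) + ξ) ^ q := by
  rw [factorial_mul_lag hqk, add_comm (k : ℝ) ξ, add_pow]
  refine (Finset.abs_sum_le_sum_abs _ _).trans (Finset.sum_le_sum fun l _ => ?_)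
  rw [abs_mul, abs_mul, abs_pow, abs_neg, abs_of_nonneg hξ, Nat.abs_cast, Nat.abs_cast]
  gcongr
  exact cast_descFactorial_le_pow k (q - l)

theorem mul_abs_factorial_mul_lag_sub_le {q k : ℕ} (hqk : q ≤ k) {ξ : ℝ} (hξ : 0 ≤ ξ) :
    (k : ℝ) * |(q.factorial : ℝ) * lag q k ξ - ((k : ℝ) - ξ) ^ q| ≤
      (q : ℝ) ^ 2 * ((k : ℝ) + ξ) ^ q := by
  rw [factorial_mul_lag hqk, sub_eq_neg_add (k : ℝ) ξ, add_pow, ← Finset.sum_sub_distrib,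
    add_comm (k : ℝ) ξ, add_pow, Finset.mul_sum]
  refine (mul_le_mul_of_nonneg_left (Finset.abs_sum_le_sum_abs _ _) k.cast_nonneg).trans ?_
  rw [Finset.mul_sum]
  refine Finset.sum_le_sum fun l _ => ?_
  rw [← sub_mul, ← mul_sub, abs_mul, abs_mul, abs_pow, abs_neg, abs_of_nonneg hξ, Nat.abs_cast,
    abs_sub_comm, abs_of_nonneg (sub_nonneg.mpr (cast_descFactorial_le_pow k (q - l)))]
  have hpow : (((q - l : ℕ) : ℝ)) ^ 2 ≤ (q : ℝ) ^ 2 := by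
    gcongr
    exact Nat.sub_le q l
  calc (k : ℝ) * (ξ ^ l * ((k : ℝ) ^ (q - l) - k.descFactorial (q - l)) * q.choose l)
      = ξ ^ l * (k * ((k : ℝ) ^ (q - l) - k.descFactorial (q - l))) * q.choose l := by ring
    _ ≤ ξ ^ l * ((q : ℝ) ^ 2 * (k : ℝ) ^ (q - l)) * q.choose l := by
        refine mul_le_mul_of_nonneg_right (mul_le_mul_of_nonneg_left ?_ (by positivity))
          (by positivity)
        exact (mul_pow_sub_descFactorial_le k (q - l)).trans
          (mul_le_mul_of_nonneg_right hpow (by positivity))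
    _ = (q : ℝ) ^ 2 * (ξ ^ l * (k : ℝ) ^ (q - l) * q.choose l) := by ring

theorem abs_sq_factorial_mul_lag_sub_le {q k : ℕ} (hk : 0 < k) (hqk : q ≤ k) {ξ : ℝ}
    (hξ : 0 ≤ ξ) :
    |((q.factorial : ℝ) * lag q k ξ) ^ 2 - ((k : ℝ) - ξ) ^ (2 * q)| ≤
      2 * (q : ℝ) ^ 2 / k * ((k : ℝ) + ξ) ^ (2 * q) := by
  have hk' : (0 : ℝ) < k := mod_cast hk
  have hdiff := mul_abs_factorial_mul_lag_sub_le hqk hξ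
  have hlag := abs_factorial_mul_lag_le hqk hξ
  have hpow : |((k : ℝ) - ξ) ^ q| ≤ ((k : ℝ) + ξ) ^ q := by
    rw [abs_pow]
    gcongr
    rw [abs_le]
    constructor <;> linarith
  set A := (q.factorial : ℝ) * lag q k ξ
  set B := ((k : ℝ) - ξ) ^ q
  set P := ((k : ℝ) + ξ) ^ q
  have hB : ((k : ℝ) - ξ) ^ (2 * q) = B ^ 2 := by rw [mul_comm, pow_mul]
  have hP : ((k : ℝ) + ξ) ^ (2 * q) = P ^ 2 := by rw [mul_comm, pow_mul]
  rw [hB, hP, sq_sub_sq, abs_mul, div_mul_eq_mul_div, le_div_iff₀ hk']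
  calc |A + B| * |A - B| * k = |A + B| * (k * |A - B|) := by ring
    _ ≤ (P + P) * ((q : ℝ) ^ 2 * P) := by
        gcongr
        exact (abs_add_le A B).trans (add_le_add hlag hpow)
    _ = 2 * (q : ℝ) ^ 2 * P ^ 2 := by ring

theorem continuous_lag (q k : ℕ) : Continuous (lag q k) := by
  unfold lag
  fun_prop

theorem nu_eq (b : ℝ) {q k : ℕ} (hqk : q ≤ k) (R : ℝ) :
    nu b q k R = 1 / ((k.factorial : ℝ) * (q.factorial : ℝ)) *
      ∫ ξ in (0:ℝ)..(b * R ^ 2 / 2),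
        Real.exp (-ξ) * ξ ^ (k - q) * ((q.factorial : ℝ) * lag q k ξ) ^ 2 := by
  have hq : (q.factorial : ℝ) ≠ 0 := mod_cast q.factorial_ne_zero
  have hk : (k.factorial : ℝ) ≠ 0 := mod_cast k.factorial_ne_zero
  rw [nu, ← intervalIntegral.integral_const_mul, ← intervalIntegral.integral_const_mul]
  congr 1
  ext ξ
  rw [← Nat.cast_sub hqk, Real.rpow_natCast]
  field_simp

/-- for q ≥ 1 there is C_q > 0 such that for k ≥ q and R > 0 (ρ = bR²/2),
|ν_{q,k}(R) − (1/(k!q!)) ∫₀^ρ e^{−ξ} ξ^{k−q}(k−ξ)^{2q} dξ|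
  ≤ (C_q/k) (1/(k!q!)) ∫₀^ρ e^{−ξ} ξ^{k−q}(k+ξ)^{2q} dξ. -/
theorem statement7 (b : ℝ) (hb : 0 < b) (q : ℕ) (hq : 1 ≤ q) :
    ∃ Cq > (0:ℝ), ∀ k : ℕ, q ≤ k → ∀ R : ℝ, 0 < R →
      |nu b q k R - (1 / ((k.factorial : ℝ) * (q.factorial : ℝ))) *
          ∫ ξ in (0:ℝ)..(b * R ^ 2 / 2), Real.exp (-ξ) * ξ ^ (k - q) * ((k : ℝ) - ξ) ^ (2 * q)|
        ≤ (Cq / k) * (1 / ((k.factorial : ℝ) * (q.factorial : ℝ))) *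
          ∫ ξ in (0:ℝ)..(b * R ^ 2 / 2), Real.exp (-ξ) * ξ ^ (k - q) * ((k : ℝ) + ξ) ^ (2 * q) := by
  refine ⟨2 * (q : ℝ) ^ 2, by positivity, fun k hqk R _ => ?_⟩
  have hρ : 0 ≤ b * R ^ 2 / 2 := by positivity
  have hlag := continuous_lag q k
  rw [nu_eq b hqk, ← mul_sub, ← intervalIntegral.integral_sub
    (Continuous.intervalIntegrable (by fun_prop) _ _)
    (Continuous.intervalIntegrable (by fun_prop) _ _), abs_mul,
    abs_of_nonneg (a := 1 / ((k.factorial : ℝ) * (q.factorial : ℝ))) (by positivity),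
    mul_comm (2 * (q : ℝ) ^ 2 / k), mul_assoc, ← intervalIntegral.integral_const_mul]
  refine mul_le_mul_of_nonneg_left ?_ (by positivity)
  refine (intervalIntegral.abs_integral_le_integral_abs hρ).trans
    (intervalIntegral.integral_mono_on hρ (Continuous.intervalIntegrable (by fun_prop) _ _)
      (Continuous.intervalIntegrable (by fun_prop) _ _) fun ξ hξ => ?_)
  have hw : 0 ≤ Real.exp (-ξ) * ξ ^ (k - q) := mul_nonneg (Real.exp_pos _).le (pow_nonneg hξ.1 _)
  rw [← mul_sub, abs_mul, abs_of_nonneg hw, mul_left_comm]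
  exact mul_le_mul_of_nonneg_left
    (abs_sq_factorial_mul_lag_sub_le (hq.trans hqk) hqk hξ.1) hw

end
end

section
/- Fix b > 0, q ∈ ℕ, and ε > 0. There exist C₀ > 0 and R₀ > 1 such that for every R ≥ R₀ and every k ∈ ℕ, one has ν_{q,k}(ε) ≥ e^{−C₀ R² log R} ( ν_{q,k}(R) − e^{−R²/C₀} ν_{q,k}(2R) ). -/
open MeasureTheory

noncomputable section

/-- The normalized Laguerre polynomial `∑ j ≤ m, C(m,j) n!/(n+j)! (-ξ)^j`, with value `1` at `0`. -/
def normLag (n m : ℕ) (ξ : ℝ) : ℝ :=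
  ∑ j ∈ Finset.range (m + 1), (m.choose j : ℝ) * n.factorial / (n + j).factorial * (-ξ) ^ j

lemma continuous_normLag (n m : ℕ) : Continuous (normLag n m) := by
  unfold normLag
  fun_prop

lemma abs_normLag_sub_one_le (n m : ℕ) {ξ : ℝ} (hξ : 0 ≤ ξ) :
    |normLag n m ξ - 1| ≤ (1 + ξ / (n + 1)) ^ m - 1 := by
  have h1 : (1 + ξ / (n + 1)) ^ m - 1 =
      ∑ j ∈ Finset.range m, (m.choose (j + 1) : ℝ) * (ξ / (n + 1)) ^ (j + 1) := by
    rw [add_comm, add_pow, Finset.sum_range_succ']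
    simp [mul_comm]
  have h2 : normLag n m ξ - 1 = ∑ j ∈ Finset.range m,
      (m.choose (j + 1) : ℝ) * n.factorial / (n + (j + 1)).factorial * (-ξ) ^ (j + 1) := by
    have : (n.factorial : ℝ) ≠ 0 := by positivity
    rw [normLag, Finset.sum_range_succ']
    simp [this]
  rw [h1, h2]
  refine (Finset.abs_sum_le_sum_abs _ _).trans (Finset.sum_le_sum fun j _ => ?_)
  have h3 : (n.factorial : ℝ) * (n + 1) ^ (j + 1) ≤ (n + (j + 1)).factorial := by
    exact_mod_cast Nat.factorial_mul_pow_le_factorial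
  rw [abs_mul, abs_pow, abs_neg, abs_of_nonneg hξ, abs_of_nonneg (by positivity), mul_div_assoc,
    mul_assoc, div_pow]
  refine mul_le_mul_of_nonneg_left ?_ (by positivity)
  rw [div_mul_eq_mul_div, div_le_div_iff₀ (by positivity) (by positivity)]
  have := mul_le_mul_of_nonneg_left h3 (pow_nonneg hξ (j + 1))
  linarith

lemma lag_add_left (q n : ℕ) (ξ : ℝ) :
    lag q (q + n) ξ = ((q + n).choose q : ℝ) * normLag n q ξ := by
  have h : q - (q + n) = 0 := by omega
  rw [lag, normLag, h, ← Finset.Ico_add_one_right_eq_Icc, Finset.sum_Ico_eq_sum_range,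
    Finset.mul_sum]
  refine Finset.sum_congr rfl fun j hj => ?_
  have hj' : j ≤ q := by simp at hj; omega
  obtain ⟨i, rfl⟩ := Nat.exists_eq_add_of_le hj'
  have e1 : j + i - (0 + j) = i := by omega
  have e2 : j + i + n = i + (n + j) := by omega
  rw [e1, Nat.cast_add_choose ℝ, e2, Nat.cast_add_choose ℝ, Nat.cast_add_choose ℝ, ← e2, zero_add]
  field_simp

lemma lag_add_right (k n : ℕ) (ξ : ℝ) :
    lag (k + n) k ξ = (-ξ) ^ n / n.factorial * normLag n k ξ := by
  have h : k + n - k = n := by omega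
  have h' : k + n + 1 - n = k + 1 := by omega
  rw [lag, normLag, h, ← Finset.Ico_add_one_right_eq_Icc, Finset.sum_Ico_eq_sum_range,
    Finset.mul_sum, h']
  refine Finset.sum_congr rfl fun j hj => ?_
  have hj' : j ≤ k := by simp at hj; omega
  have e1 : k + n - (n + j) = k - j := by omega
  rw [e1, Nat.choose_symm hj', pow_add]
  field_simp

/-- The weighted integral `∫₀ᵗ ξⁿ P(ξ)² e^{-ξ} dξ` of a normalized Laguerre polynomial `P`. -/
def lagMass (n m : ℕ) (t : ℝ) : ℝ :=
  ∫ ξ in (0:ℝ)..t, ξ ^ n * normLag n m ξ ^ 2 * Real.exp (-ξ)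

lemma nu_eq_of_forall_pos {q k n m : ℕ} {c : ℝ}
    (h : ∀ ξ : ℝ, 0 < ξ → ξ ^ ((k : ℝ) - q) * lag q k ξ ^ 2 = c * (ξ ^ n * normLag n m ξ ^ 2))
    (b R : ℝ) (hb : 0 < b) :
    nu b q k R = (q.factorial / k.factorial : ℝ) * c * lagMass n m (b * R ^ 2 / 2) := by
  rw [nu, lagMass, mul_assoc, ← intervalIntegral.integral_const_mul c]
  congr 1
  refine intervalIntegral.integral_congr_ae (Filter.Eventually.of_forall fun ξ hξ => ?_)
  rw [Set.uIoc_of_le (by positivity)] at hξ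
  rw [h ξ hξ.1]
  ring

lemma exists_nu_eq (q k : ℕ) : ∃ A : ℝ, 0 ≤ A ∧ ∃ n m : ℕ, m ≤ q ∧
    ∀ b R : ℝ, 0 < b → nu b q k R = A * lagMass n m (b * R ^ 2 / 2) := by
  rcases le_total q k with h | h
  · obtain ⟨n, rfl⟩ := Nat.exists_eq_add_of_le h
    refine ⟨_, ?_, n, q, le_rfl, nu_eq_of_forall_pos (c := ((q + n).choose q : ℝ) ^ 2) ?_⟩
    · positivity
    · intro ξ hξ
      rw [lag_add_left]
      push_cast
      rw [add_sub_cancel_left, Real.rpow_natCast]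
      ring
  · obtain ⟨n, rfl⟩ := Nat.exists_eq_add_of_le h
    refine ⟨_, ?_, n, k, h, nu_eq_of_forall_pos (c := ((n.factorial : ℝ) ^ 2)⁻¹) ?_⟩
    · positivity
    · intro ξ hξ
      rw [lag_add_right]
      push_cast
      rw [sub_add_cancel_left, Real.rpow_neg hξ.le, Real.rpow_natCast, mul_pow, div_pow,
        ← pow_mul, mul_comm n 2, pow_mul, neg_sq]
      field_simp
      rw [pow_right_comm]

lemma intervalIntegrable_lagMass (n m : ℕ) (s t : ℝ) :
    IntervalIntegrable (fun ξ : ℝ => ξ ^ n * normLag n m ξ ^ 2 * Real.exp (-ξ)) volume s t := by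
  have := continuous_normLag n m
  exact Continuous.intervalIntegrable (by fun_prop) _ _

lemma lagMass_nonneg (n m : ℕ) {t : ℝ} (ht : 0 ≤ t) : 0 ≤ lagMass n m t := by
  refine intervalIntegral.integral_nonneg ht fun ξ hξ => ?_
  have := hξ.1
  positivity

lemma lagMass_mono (n m : ℕ) {s t : ℝ} (hs : 0 ≤ s) (hst : s ≤ t) :
    lagMass n m s ≤ lagMass n m t := by
  rw [lagMass, lagMass, ← intervalIntegral.integral_add_adjacent_intervals
    (intervalIntegrable_lagMass n m 0 s) (intervalIntegrable_lagMass n m s t)]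
  refine le_add_of_nonneg_right (intervalIntegral.integral_nonneg hst fun ξ hξ => ?_)
  have := hs.trans hξ.1
  positivity

lemma lagMass_mul (n m : ℕ) (c t : ℝ) :
    lagMass n m (c * t) = ∫ ξ in (0:ℝ)..t,
      c ^ (n + 1) * (ξ ^ n * normLag n m (c * ξ) ^ 2 * Real.exp (-(c * ξ))) := by
  have h := intervalIntegral.smul_integral_comp_mul_left (a := 0) (b := t)
    (fun ξ : ℝ => ξ ^ n * normLag n m ξ ^ 2 * Real.exp (-ξ)) c
  rw [mul_zero] at h
  rw [lagMass, ← h, smul_eq_mul, ← intervalIntegral.integral_const_mul]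
  congr 1
  ext ξ
  ring

lemma intervalIntegrable_lagMass_mul (n m : ℕ) (c s t : ℝ) :
    IntervalIntegrable (fun ξ : ℝ =>
      c ^ (n + 1) * (ξ ^ n * normLag n m (c * ξ) ^ 2 * Real.exp (-(c * ξ)))) volume s t := by
  have := continuous_normLag n m
  exact Continuous.intervalIntegrable (by fun_prop) _ _

/-- Radius, as a multiple of `n + 1`, on which `normLag n m` is close to `1` for all `m ≤ q`. -/
def lagRadius (q : ℕ) : ℝ := Real.log (3 / 2) / (q + 1)

lemma lagRadius_pos (q : ℕ) : 0 < lagRadius q := by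
  have : 0 < Real.log (3 / 2) := Real.log_pos (by norm_num)
  unfold lagRadius
  positivity

lemma lagRadius_le_one (q : ℕ) : lagRadius q ≤ 1 := by
  rw [lagRadius, div_le_one (by positivity)]
  have : Real.log (3 / 2) ≤ 3 / 2 - 1 := Real.log_le_sub_one_of_pos (by norm_num)
  have : (0:ℝ) ≤ q := by positivity
  linarith

lemma normLag_mem_Icc {n m q : ℕ} (hm : m ≤ q) {ξ : ℝ} (h0 : 0 ≤ ξ)
    (h : ξ ≤ lagRadius q * (n + 1)) : normLag n m ξ ∈ Set.Icc (1 / 2 : ℝ) (3 / 2) := by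
  have h1 : ξ / (n + 1) ≤ lagRadius q := by rwa [div_le_iff₀ (by positivity)]
  have h2 : (1 + ξ / (n + 1)) ^ m ≤ 3 / 2 := calc
    (1 + ξ / (n + 1)) ^ m ≤ (1 + ξ / (n + 1)) ^ q :=
      pow_le_pow_right₀ (le_add_of_nonneg_right (by positivity)) hm
    _ ≤ (Real.exp (lagRadius q)) ^ q := by
      gcongr
      linarith [Real.add_one_le_exp (lagRadius q)]
    _ = Real.exp (q * lagRadius q) := (Real.exp_nat_mul _ _).symm
    _ ≤ Real.exp ((q + 1) * lagRadius q) := by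
      have := lagRadius_pos q
      gcongr
      linarith
    _ = 3 / 2 := by
      rw [lagRadius, mul_div_cancel₀ _ (by positivity), Real.exp_log (by norm_num)]
  have h3 := abs_le.1 (abs_normLag_sub_one_le n m h0)
  constructor <;> linarith [h3.1, h3.2]

lemma abs_normLag_le {n m q : ℕ} (hm : m ≤ q) {ξ : ℝ} (h0 : 0 ≤ ξ) :
    |normLag n m ξ| ≤ (1 + ξ) ^ q := by
  have h3 : |normLag n m ξ| ≤ |normLag n m ξ - 1| + |1| := by
    simpa using abs_add_le (normLag n m ξ - 1) 1
  have h4 := abs_normLag_sub_one_le n m h0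
  rw [abs_one] at h3
  calc |normLag n m ξ| ≤ (1 + ξ / (n + 1)) ^ m := by linarith
    _ ≤ (1 + ξ) ^ m := by
      gcongr
      exact div_le_self h0 (by simp)
    _ ≤ (1 + ξ) ^ q := pow_le_pow_right₀ (by linarith) hm

lemma lagMass_le_exp_mul_lagMass_four_mul {n m q : ℕ} (hm : m ≤ q) {t : ℝ} (ht : 2 ≤ t)
    (hn : 5 / lagRadius q * t ≤ n) :
    lagMass n m t ≤ Real.exp (-t) * lagMass n m (4 * t) := by
  have hδ := lagRadius_pos q
  have hδ1 := lagRadius_le_one q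
  have h1 : 5 * t ≤ lagRadius q * n := by
    rw [div_mul_eq_mul_div, div_le_iff₀ hδ] at hn
    linarith
  have h2 : 5 * t ≤ n := h1.trans (mul_le_of_le_one_left (by positivity) hδ1)
  rw [lagMass_mul, ← intervalIntegral.integral_const_mul, lagMass]
  refine intervalIntegral.integral_mono_on (by linarith) (intervalIntegrable_lagMass n m 0 t)
    ((intervalIntegrable_lagMass_mul n m 4 0 t).const_mul _) fun ξ hξ => ?_
  obtain ⟨hξ0, hξt⟩ := hξ
  obtain ⟨-, ha⟩ := normLag_mem_Icc (n := n) hm hξ0 (by linarith)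
  obtain ⟨ha', -⟩ := normLag_mem_Icc (n := n) hm hξ0 (by linarith)
  obtain ⟨hb, -⟩ := normLag_mem_Icc (n := n) (ξ := 4 * ξ) hm (by linarith) (by linarith)
  have h3 : normLag n m ξ ^ 2 ≤ 9 * normLag n m (4 * ξ) ^ 2 := by nlinarith
  have h4 : Real.exp (5 * t) ≤ 4 ^ n := calc
    Real.exp (5 * t) ≤ Real.exp ((n : ℝ) * 1) := Real.exp_le_exp.2 (by linarith)
    _ = Real.exp 1 ^ n := Real.exp_nat_mul _ _
    _ ≤ 4 ^ n := by
      gcongr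
      linarith [Real.exp_one_lt_d9]
  have h5 : 9 * Real.exp (-ξ) ≤ Real.exp (-t) * (4 ^ (n + 1) * Real.exp (-(4 * ξ))) := by
    have h6 : 3 ≤ Real.exp t := by linarith [Real.add_one_le_exp t]
    calc 9 * Real.exp (-ξ) ≤ (Real.exp t * 4) * Real.exp (-ξ) := by gcongr; linarith
      _ ≤ (Real.exp t * 4) * (Real.exp (3 * t) * Real.exp (-(4 * ξ))) := by
        rw [← Real.exp_add]
        gcongr
        linarith
      _ = Real.exp (-t) * (Real.exp (5 * t) * 4 * Real.exp (-(4 * ξ))) := by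
        have : Real.exp t * Real.exp (3 * t) = Real.exp (-t) * Real.exp (5 * t) := by
          rw [← Real.exp_add, ← Real.exp_add]
          ring_nf
        linear_combination 4 * Real.exp (-(4 * ξ)) * this
      _ ≤ Real.exp (-t) * (4 ^ (n + 1) * Real.exp (-(4 * ξ))) := by
        rw [pow_succ]
        gcongr
  calc ξ ^ n * normLag n m ξ ^ 2 * Real.exp (-ξ)
      ≤ ξ ^ n * (9 * normLag n m (4 * ξ) ^ 2) * Real.exp (-ξ) := by gcongr
    _ = ξ ^ n * normLag n m (4 * ξ) ^ 2 * (9 * Real.exp (-ξ)) := by ring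
    _ ≤ ξ ^ n * normLag n m (4 * ξ) ^ 2 *
        (Real.exp (-t) * (4 ^ (n + 1) * Real.exp (-(4 * ξ)))) := by gcongr
    _ = _ := by ring

lemma lagMass_le_pow_mul_lagMass {n m q : ℕ} (hm : m ≤ q) {s t : ℝ} (hs : 0 < s)
    (hsq : s ≤ lagRadius q) (ht : 0 ≤ t) :
    lagMass n m t ≤ 12 * (t / s) ^ (n + 1) * (1 + t) ^ (2 * q) * lagMass n m s := by
  have hts : t = t / s * s := by field_simp
  have hs1 : s ≤ 1 := hsq.trans (lagRadius_le_one q)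
  have hδ := lagRadius_pos q
  conv_lhs => rw [hts]
  rw [lagMass_mul, lagMass, ← intervalIntegral.integral_const_mul]
  refine intervalIntegral.integral_mono_on hs.le (intervalIntegrable_lagMass_mul n m _ 0 s)
    ((intervalIntegrable_lagMass n m 0 s).const_mul _) fun ξ hξ => ?_
  obtain ⟨hξ0, hξs⟩ := hξ
  have hc : 0 ≤ t / s := by positivity
  have hct : t / s * ξ ≤ t := by
    conv_rhs => rw [hts]
    gcongr
  obtain ⟨ha, -⟩ := normLag_mem_Icc (n := n) hm hξ0
    ((hξs.trans hsq).trans (le_mul_of_one_le_right hδ.le (by simp)))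
  have hP : normLag n m (t / s * ξ) ^ 2 ≤ (1 + t) ^ (2 * q) := calc
    normLag n m (t / s * ξ) ^ 2 = |normLag n m (t / s * ξ)| ^ 2 := (sq_abs _).symm
    _ ≤ ((1 + t / s * ξ) ^ q) ^ 2 := by
      gcongr
      exact abs_normLag_le hm (by positivity)
    _ = (1 + t / s * ξ) ^ (2 * q) := by rw [← pow_mul, mul_comm q]
    _ ≤ (1 + t) ^ (2 * q) := by gcongr
  have hexp : Real.exp (-(t / s * ξ)) ≤ 1 := Real.exp_le_one_iff.2 (by
    have : 0 ≤ t / s * ξ := by positivity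
    linarith)
  have hlow : 1 ≤ 12 * (normLag n m ξ ^ 2 * Real.exp (-ξ)) := by
    have h1 : 1 / 4 ≤ normLag n m ξ ^ 2 := by nlinarith
    have h2 : 1 / 3 ≤ Real.exp (-ξ) := by
      rw [Real.exp_neg, ← one_div]
      have : Real.exp ξ ≤ Real.exp 1 := Real.exp_le_exp.2 (by linarith)
      exact one_div_le_one_div_of_le (Real.exp_pos _) (by linarith [Real.exp_one_lt_d9])
    have := mul_le_mul h1 h2 (by norm_num) (by positivity)
    linarith
  calc (t / s) ^ (n + 1) * (ξ ^ n * normLag n m (t / s * ξ) ^ 2 * Real.exp (-(t / s * ξ)))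
      ≤ (t / s) ^ (n + 1) * (ξ ^ n * (1 + t) ^ (2 * q) * 1) := by gcongr
    _ = (t / s) ^ (n + 1) * ξ ^ n * (1 + t) ^ (2 * q) * 1 := by ring
    _ ≤ (t / s) ^ (n + 1) * ξ ^ n * (1 + t) ^ (2 * q) *
        (12 * (normLag n m ξ ^ 2 * Real.exp (-ξ))) := by gcongr
    _ = _ := by ring

/-- for ε > 0 there are C₀ > 0 and R₀ > 1 such that for every R ≥ R₀ and
every k ∈ ℕ, ν_{q,k}(ε) ≥ e^{−C₀R² log R} (ν_{q,k}(R) − e^{−R²/C₀} ν_{q,k}(2R)). -/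
theorem statement12 (b : ℝ) (hb : 0 < b) (q : ℕ) (ε : ℝ) (hε : 0 < ε) :
    ∃ C₀ > (0:ℝ), ∃ R₀ > (1:ℝ), ∀ R : ℝ, R₀ ≤ R → ∀ k : ℕ,
      Real.exp (-(C₀ * R ^ 2 * Real.log R)) *
        (nu b q k R - Real.exp (-(R ^ 2 / C₀)) * nu b q k (2 * R)) ≤ nu b q k ε := by
  have hδ := lagRadius_pos q
  set s := min (lagRadius q) (b * ε ^ 2 / 2)
  have hs : 0 < s := lt_min hδ (by positivity)
  set K := 5 / lagRadius q
  have hK : 0 < K := by positivity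
  set C₀ := 3 * K * b / 2 + 6 * q + 4 + 2 / b with hC_def
  have hC : 0 < C₀ := by positivity
  have hp1 : 0 < b / (2 * s) := by positivity
  have hp2 : 0 < 4 / b := by positivity
  refine ⟨C₀, hC, 12 + b / (2 * s) + b + 4 / b, by linarith, fun R hR k => ?_⟩
  have hR12 : 12 ≤ R := by linarith
  have hR0 : 0 < R := by linarith
  have hRs : b / (2 * s) ≤ R := by linarith
  have hRb : b + 1 ≤ R := by linarith
  have hR4 : 4 ≤ b * R := by
    have : 4 / b ≤ R := by linarith
    rwa [div_le_iff₀' hb] at this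
  obtain ⟨A, hA, n, m, hm, hnu⟩ := exists_nu_eq q k
  set ρ := b * R ^ 2 / 2 with hρ_def
  have hρ2 : 2 ≤ ρ := by nlinarith
  rw [hnu b R hb, hnu b (2 * R) hb, hnu b ε hb,
    show b * (2 * R) ^ 2 / 2 = 4 * ρ by rw [hρ_def]; ring, ← hρ_def]
  have hJε : 0 ≤ lagMass n m (b * ε ^ 2 / 2) := lagMass_nonneg n m (by positivity)
  have hJ4 : 0 ≤ lagMass n m (4 * ρ) := lagMass_nonneg n m (by linarith)
  rw [show ∀ x y z w : ℝ, x * (A * y - z * (A * w)) = A * (x * (y - z * w)) by intros; ring]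
  refine mul_le_mul_of_nonneg_left ?_ hA
  rcases le_total (K * ρ) n with h | h
  · refine le_trans (mul_nonpos_of_nonneg_of_nonpos (Real.exp_pos _).le ?_) hJε
    have h1 := lagMass_le_exp_mul_lagMass_four_mul hm hρ2 h
    have h2 : R ^ 2 / C₀ ≤ ρ := by
      have h3 : 2 / b ≤ C₀ := by
        have : 0 ≤ 3 * K * b / 2 + 6 * q + 4 := by positivity
        linarith
      rw [div_le_iff₀ hb] at h3
      rw [div_le_iff₀ hC, hρ_def]
      nlinarith [sq_nonneg R]
    have h4 : Real.exp (-ρ) * lagMass n m (4 * ρ) ≤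
        Real.exp (-(R ^ 2 / C₀)) * lagMass n m (4 * ρ) := by gcongr
    linarith
  · have h1 := lagMass_le_pow_mul_lagMass (n := n) hm hs (min_le_left _ _) (t := ρ) (by linarith)
    have h2 : lagMass n m s ≤ lagMass n m (b * ε ^ 2 / 2) :=
      lagMass_mono n m hs.le (min_le_right _ _)
    have hρs : ρ / s ≤ R ^ 3 := calc
      ρ / s = b / (2 * s) * R ^ 2 := by rw [hρ_def]; field_simp
      _ ≤ R * R ^ 2 := by gcongr
      _ = R ^ 3 := by ring
    have hρ1 : 1 + ρ ≤ R ^ 3 := by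
      have : (b + 1) * R ^ 2 ≤ R * R ^ 2 := by gcongr
      rw [hρ_def]
      nlinarith
    have hρ0 : 0 ≤ ρ := by linarith
    have hlog : 0 ≤ Real.log R := Real.log_nonneg (by linarith)
    have h3 : 12 * (ρ / s) ^ (n + 1) * (1 + ρ) ^ (2 * q) ≤
        Real.exp (C₀ * R ^ 2 * Real.log R) := calc
      12 * (ρ / s) ^ (n + 1) * (1 + ρ) ^ (2 * q)
          ≤ R * (R ^ 3) ^ (n + 1) * (R ^ 3) ^ (2 * q) := by gcongr
      _ = R ^ (3 * n + 6 * q + 4) := by ring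
      _ = Real.exp ((3 * n + 6 * q + 4) * Real.log R) := by
        rw [← Real.exp_log (pow_pos hR0 (3 * n + 6 * q + 4)), Real.log_pow]
        push_cast
        rfl
      _ ≤ Real.exp (C₀ * R ^ 2 * Real.log R) := by
        gcongr
        have h5 : 1 ≤ R ^ 2 := by nlinarith
        have h6 : (6 * q + 4 : ℝ) * 1 ≤ (6 * q + 4) * R ^ 2 := by gcongr
        have h7 : 0 ≤ 2 / b * R ^ 2 := by positivity
        have h8 : C₀ * R ^ 2 = 3 * (K * ρ) + (6 * q + 4) * R ^ 2 + 2 / b * R ^ 2 := by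
          rw [hC_def, hρ_def]; ring
        linarith
    have hJs : 0 ≤ lagMass n m s := lagMass_nonneg n m hs.le
    calc Real.exp (-(C₀ * R ^ 2 * Real.log R)) *
          (lagMass n m ρ - Real.exp (-(R ^ 2 / C₀)) * lagMass n m (4 * ρ))
        ≤ Real.exp (-(C₀ * R ^ 2 * Real.log R)) * lagMass n m ρ := by
          gcongr
          exact sub_le_self _ (by positivity)
      _ ≤ Real.exp (-(C₀ * R ^ 2 * Real.log R)) *
          (Real.exp (C₀ * R ^ 2 * Real.log R) * lagMass n m (b * ε ^ 2 / 2)) := by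
          gcongr
          exact h1.trans (by gcongr)
      _ = lagMass n m (b * ε ^ 2 / 2) := by
          rw [← mul_assoc, ← Real.exp_add, neg_add_cancel, Real.exp_zero, one_mul]

end
end
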